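/- Let A be a poset with least element ⊥ and greatest element ⊤, and let G be a composite premotive game with parity over A such that none of the options of G are dominated and all reversible options of G are simple. If G ≃ [x] for some x ∈ A, then G is identical to the game ⟨⟨[⊥]|[x]⟩ | ⟨[x]|[⊤]⟩⟩. -/

import Mathlib

/-- Games over a poset `α`: atomic games `[a]` for `a : α`, and composite games
`⟨L|R⟩` given by nonempty families of left and right options. -/
inductive Game (α : Type) : Type 1 where
  | atom : α → Game α
  | comp : (ι κ : Type) → (ι → Game α) → (κ → Game α) → Nonempty ι → Nonempty κ → Game α

namespace Game

variable {α β : Type}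

/-- `G'` is a left option of the game. -/
def IsLeftOption (G' : Game α) : Game α → Prop
  | atom _ => False
  | comp _ _ L _ _ _ => ∃ i, L i = G'

/-- `G'` is a right option of the game. -/
def IsRightOption (G' : Game α) : Game α → Prop
  | atom _ => False
  | comp _ _ _ R _ _ => ∃ k, R k = G'

/-- `G'` is an option of `G`. -/
def IsOption (G' G : Game α) : Prop := IsLeftOption G' G ∨ IsRightOption G' G

/-- A game is composite if it is not atomic. -/
def IsComposite : Game α → Prop
  | atom _ => False
  | comp _ _ _ _ _ _ => True

/-- `G'` is a follower of `G`: `G` itself, an option of `G`, or recursively a follower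
of an option of `G`. -/
def IsFollower (G' G : Game α) : Prop := Relation.ReflTransGen IsOption G' G

/-- The dual game: Left and Right switch sides; it is a game over the opposite poset. -/
def dual : Game α → Game αᵒᵈ
  | atom a => atom (OrderDual.toDual a)
  | comp ι κ L R hι hκ => comp κ ι (fun k => (R k).dual) (fun i => (L i).dual) hκ hι

/-- The image of a game under a (monotone) function applied to atoms. -/
def map (f : α → β) : Game α → Game β
  | atom a => atom (f a)
  | comp ι κ L R hι hκ => comp ι κ (fun i => (L i).map f) (fun k => (R k).map f) hι hκ

/-- The (disjunctive) sum of a game over `α` and a game over `β`, a game over `α × β`. -/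
noncomputable def add : Game α → Game β → Game (α × β) := by
  intro G
  induction G with
  | atom g =>
    intro H
    induction H with
    | atom h => exact atom (g, h)
    | comp ι κ L R hι hκ IHL IHR => exact comp ι κ IHL IHR hι hκ
  | comp ι κ L R hι hκ IHL IHR =>
    intro H
    induction H with
    | atom h => exact comp ι κ (fun i => IHL i (atom h)) (fun k => IHR k (atom h)) hι hκ
    | comp ι' κ' L' R' hι' hκ' IHL' IHR' =>
      exact comp (ι ⊕ ι') (κ ⊕ κ')
        (Sum.elim (fun i => IHL i (comp ι' κ' L' R' hι' hκ')) IHL')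
        (Sum.elim (fun k => IHR k (comp ι' κ' L' R' hι' hκ')) IHR')
        (hι.elim fun i => ⟨Sum.inl i⟩) (hκ.elim fun k => ⟨Sum.inl k⟩)

mutual
/-- Left has a first player winning strategy in a game over the boolean poset:
either the game is the atom `⊤`, or some left option has a second player
winning strategy for Left. -/
inductive LeftWinsFirst : Game Bool → Prop where
  | atom_top : LeftWinsFirst (atom true)
  | move {G G' : Game Bool} : IsLeftOption G' G → LeftWinsSecond G' → LeftWinsFirst G

/-- Left has a second player winning strategy in a game over the boolean poset:
every right option has a first player winning strategy for Left, and if the game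
is atomic it is the atom `⊤`. -/
inductive LeftWinsSecond : Game Bool → Prop where
  | mk {G : Game Bool} : (∀ G', IsRightOption G' G → LeftWinsFirst G') →
      (∀ b, G = atom b → b = true) → LeftWinsSecond G
end

mutual
/-- A game is even if all of its options are odd (atomic games are even). -/
inductive Even {α : Type} : Game α → Prop where
  | mk {G : Game α} : (∀ G', IsOption G' G → Odd G') → Even G

/-- A game is odd if it is composite and all of its options are even. -/
inductive Odd {α : Type} : Game α → Prop where
  | mk {G : Game α} : G.IsComposite → (∀ G', IsOption G' G → Even G') → Odd G
end

/-- A game has parity if it is even or odd. -/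
def HasParity (G : Game α) : Prop := Even G ∨ Odd G

/-- `G` and `H` have matching parity (both even or both odd). -/
def MatchingParity (G H : Game α) : Prop := (Even G ∧ Even H) ∨ (Odd G ∧ Odd H)

/-- `G` and `H` have mismatching parity (one even, the other odd). -/
def MismatchParity (G H : Game α) : Prop := (Even G ∧ Odd H) ∨ (Odd G ∧ Even H)

mutual
/-- The intrinsic order `G ≤ H` on games over a poset: every left option `G^L` of `G`
satisfies `G^L ◁ H`, every right option `H^R` of `H` satisfies `G ◁ H^R`, and if
both games are atoms `[g]`, `[h]` then `g ≤ h`. -/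
inductive Le {α : Type} [PartialOrder α] : Game α → Game α → Prop where
  | mk {G H : Game α} :
      (∀ G', IsLeftOption G' G → Tri G' H) →
      (∀ H', IsRightOption H' H → Tri G H') →
      (∀ g h, G = atom g → H = atom h → g ≤ h) →
      Le G H

/-- The intrinsic relation `G ◁ H` on games over a poset: some right option `G^R` of `G`
satisfies `G^R ≤ H`, or some left option `H^L` of `H` satisfies `G ≤ H^L`. -/
inductive Tri {α : Type} [PartialOrder α] : Game α → Game α → Prop where
  | inr {G H G' : Game α} : IsRightOption G' G → Le G' H → Tri G H
  | inl {G H H' : Game α} : IsLeftOption H' H → Le G H' → Tri G H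
end

/-- The comparison game `λ(Gᵒᵖ + H)`, a game over the boolean poset, where
`λ : αᵒᵈ × α → 𝔹` is the monotone map with `λ(xᵒᵖ, y) = ⊤` iff `x ≤ y`. -/
noncomputable def comparison [PartialOrder α] (G H : Game α) : Game Bool :=
  map (fun p : αᵒᵈ × α => @decide (OrderDual.ofDual p.1 ≤ p.2) (Classical.propDecidable _))
    (G.dual.add H)

/-- A game is locally premotive if Left has a first player winning strategy in
the comparison game `λ(Gᵒᵖ + G)`. -/
def LocallyPremotive [PartialOrder α] (G : Game α) : Prop := LeftWinsFirst (comparison G G)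

/-- A game is premotive if it and all of its followers are locally premotive. -/
def Premotive [PartialOrder α] (G : Game α) : Prop :=
  ∀ G', IsFollower G' G → LocallyPremotive G'

/-- The game `* = ⟨0|0⟩` over the one-element poset. -/
def star : Game Unit := comp Unit Unit (fun _ => atom ()) (fun _ => atom ()) ⟨()⟩ ⟨()⟩

/-- `G + *`, identified with a game over `α` via the isomorphism `α × 1 ≅ α`. -/
noncomputable def addStar (G : Game α) : Game α := map Prod.fst (G.add star)

/-- A game is locally `*`-antimonotone if `G^L + * ≤ G ≤ G^R + *` for all left and
right options `G^L`, `G^R`. -/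
def LocallyStarAnti [PartialOrder α] (G : Game α) : Prop :=
  (∀ G', IsLeftOption G' G → Le G'.addStar G) ∧ (∀ G', IsRightOption G' G → Le G G'.addStar)

/-- A game is `*`-antimonotone if it and all of its followers are locally
`*`-antimonotone. -/
def StarAnti [PartialOrder α] (G : Game α) : Prop :=
  ∀ G', IsFollower G' G → LocallyStarAnti G'

/-- `ε(G + X)`: the game `G` over `α` embedded in a context `X`, a game over the poset
`[α, 𝔹]` of monotone functions `α → 𝔹`, via the application map `ε(a, f) = f a`. -/
noncomputable def ctxSum [PartialOrder α] (G : Game α) (X : Game (α →o Bool)) : Game Bool :=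
  map (fun p : α × (α →o Bool) => p.2 p.1) (G.add X)

/-- The outcome `(o_L(G), o_R(G)) ∈ 𝔹 × 𝔹` of a game over the boolean poset:
`o_L(G) = ⊤` iff Left has a first player winning strategy and `o_R(G) = ⊤` iff
Left has a second player winning strategy. -/
noncomputable def outcome (G : Game Bool) : Bool × Bool :=
  (@decide (LeftWinsFirst G) (Classical.propDecidable _),
   @decide (LeftWinsSecond G) (Classical.propDecidable _))

/-- The contextual order `G ≤_c H`: `o(G+X) ≤ o(H+X)` for every context `X`. -/
def ContextualLe [PartialOrder α] (G H : Game α) : Prop :=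
  ∀ X : Game (α →o Bool), outcome (ctxSum G X) ≤ outcome (ctxSum H X)

/-- The contextual relation `G ◁_c H`: `o_R(G+X) ≤ o_L(H+X)` for every context `X`. -/
def ContextualTri [PartialOrder α] (G H : Game α) : Prop :=
  ∀ X : Game (α →o Bool), (outcome (ctxSum G X)).2 ≤ (outcome (ctxSum H X)).1

/-- Two games are identical when they are equal as set-based games: both are the same
atom, or both are composite with identical sets of left options and identical sets of
right options (recursively). -/
def Identical : Game α → Game α → Prop
  | atom a, atom b => a = b
  | comp _ _ L R _ _, comp _ _ L' R' _ _ =>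
      ((∀ i, ∃ i', Identical (L i) (L' i')) ∧ (∀ i', ∃ i, Identical (L i) (L' i'))) ∧
      ((∀ k, ∃ k', Identical (R k) (R' k')) ∧ (∀ k', ∃ k, Identical (R k) (R' k')))
  | _, _ => False

/-- Two-step induction on games. -/
theorem two_step {Q : Game α → Prop}
    (h : ∀ G, (∀ G' G'', IsOption G' G → IsOption G'' G' → Q G'') → Q G) (G : Game α) : Q G := by
  have key : ∀ G : Game α, Q G ∧ ∀ G', IsOption G' G → Q G' := by
    intro G
    induction G with
    | atom a =>
      have h0 : ∀ G', ¬ IsOption G' (atom a) := by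
        rintro G' (h1 | h1) <;> exact h1
      exact ⟨h _ fun G' _ h1 => absurd h1 (h0 G'), fun G' h1 => absurd h1 (h0 G')⟩
    | comp ι κ L R hι hκ ihL ihR =>
      have h1 : ∀ G', IsOption G' (comp ι κ L R hι hκ) → Q G' ∧ ∀ G'', IsOption G'' G' → Q G'' := by
        rintro G' (⟨i, rfl⟩ | ⟨i, rfl⟩)
        · exact ihL i
        · exact ihR i
      exact ⟨h _ fun G' G'' h2 h3 => (h1 G' h2).2 G'' h3, fun G' h2 => (h1 G' h2).1⟩
  exact (key G).1

theorem tri_atom_right [PartialOrder α] {G : Game α} {x : α} (h : Tri G (atom x)) :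
    ∃ K, IsRightOption K G ∧ Le K (atom x) := by
  cases h with
  | inr h1 h2 => exact ⟨_, h1, h2⟩
  | inl h1 h2 => exact h1.elim

theorem tri_atom_left [PartialOrder α] {G : Game α} {x : α} (h : Tri (atom x) G) :
    ∃ K, IsLeftOption K G ∧ Le (atom x) K := by
  cases h with
  | inr h1 h2 => exact h1.elim
  | inl h1 h2 => exact ⟨_, h1, h2⟩

theorem le_atom_left [PartialOrder α] {G H : Game α} (h : Le G H) :
    ∀ G', IsLeftOption G' G → Tri G' H := by
  cases h with
  | mk h1 h2 h3 => exact h1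

theorem le_atom_right [PartialOrder α] {G H : Game α} (h : Le G H) :
    ∀ H', IsRightOption H' H → Tri G H' := by
  cases h with
  | mk h1 h2 h3 => exact h2

theorem le_atoms [PartialOrder α] {g h : α} (hh : Le (atom g) (atom h)) : g ≤ h := by
  cases hh with
  | mk h1 h2 h3 => exact h3 _ _ rfl rfl

theorem atoms_le [PartialOrder α] {g h : α} (hh : g ≤ h) : Le (atom g) (atom h) := by
  refine Le.mk (fun _ h => h.elim) (fun _ h => h.elim) ?_
  intro a b ha hb
  cases ha
  cases hb
  exact hh

theorem le_trans_atom [PartialOrder α] (x : α) (G : Game α) :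
    ∀ K, Le G (atom x) → Le (atom x) K → Le G K := by
  induction G using two_step with
  | h G ihG =>
  intro K
  induction K using two_step with
  | h K ihK =>
  intro h1 h2
  refine Le.mk ?_ ?_ ?_
  · intro G' hG'
    obtain ⟨G'', hr, hle⟩ := tri_atom_right (le_atom_left h1 G' hG')
    exact Tri.inr hr (ihG G' G'' (Or.inl hG') (Or.inr hr) K hle h2)
  · intro K' hK'
    obtain ⟨K'', hr, hle⟩ := tri_atom_left (le_atom_right h2 K' hK')
    exact Tri.inl hr (ihK K' K'' (Or.inr hK') (Or.inl hr) h1 hle)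
  · rintro g k rfl rfl
    exact (le_atoms h1).trans (le_atoms h2)

theorem wins_first [PartialOrder α] {G H : Game α} (h : LeftWinsFirst (comparison G H)) :
    (∃ a b, G = atom a ∧ H = atom b ∧ a ≤ b) ∨
    (∃ G', IsRightOption G' G ∧ LeftWinsSecond (comparison G' H)) ∨
    (∃ H', IsLeftOption H' H ∧ LeftWinsSecond (comparison G H')) := by
  generalize hX : comparison G H = X at h
  cases h with
  | atom_top =>
    cases G <;> cases H
    · refine Or.inl ⟨_, _, rfl, rfl, ?_⟩
      have h1 := Game.atom.inj hX
      exact @of_decide_eq_true _ (Classical.propDecidable _) h1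
    all_goals exact Game.noConfusion rfl (heq_of_eq hX)
  | move h1 h2 =>
    subst hX
    cases G <;> cases H
    · exact h1.elim
    · obtain ⟨i, rfl⟩ := h1
      exact Or.inr (Or.inr ⟨_, ⟨i, rfl⟩, h2⟩)
    · obtain ⟨i, rfl⟩ := h1
      exact Or.inr (Or.inl ⟨_, ⟨i, rfl⟩, h2⟩)
    · obtain ⟨i | i, rfl⟩ := h1
      · exact Or.inr (Or.inl ⟨_, ⟨i, rfl⟩, h2⟩)
      · exact Or.inr (Or.inr ⟨_, ⟨i, rfl⟩, h2⟩)

theorem wins_second [PartialOrder α] {G H : Game α} (h : LeftWinsSecond (comparison G H)) :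
    (∀ G', IsLeftOption G' G → LeftWinsFirst (comparison G' H)) ∧
    (∀ H', IsRightOption H' H → LeftWinsFirst (comparison G H')) := by
  cases h with
  | mk h1 _ =>
    cases G <;> cases H
    · exact ⟨fun _ h => h.elim, fun _ h => h.elim⟩
    · refine ⟨fun _ h => h.elim, ?_⟩
      rintro _ ⟨i, rfl⟩
      exact h1 _ ⟨i, rfl⟩
    · refine ⟨?_, fun _ h => h.elim⟩
      rintro _ ⟨i, rfl⟩
      exact h1 _ ⟨i, rfl⟩
    · constructor
      · rintro _ ⟨i, rfl⟩
        exact h1 _ ⟨Sum.inl i, rfl⟩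
      · rintro _ ⟨i, rfl⟩
        exact h1 _ ⟨Sum.inr i, rfl⟩

theorem identical_atom {H : Game α} {a : α} (h : Identical H (atom a)) : H = atom a := by
  cases H with
  | atom b => simp only [Identical] at h; rw [h]
  | comp => simp only [Identical] at h

theorem identical_simple {H : Game α} {a b : α}
    (h : Identical H (comp Unit Unit (fun _ => atom a) (fun _ => atom b) ⟨()⟩ ⟨()⟩)) :
    (∀ K, IsLeftOption K H → K = atom a) ∧ (∀ K, IsRightOption K H → K = atom b) ∧
    IsLeftOption (atom a) H ∧ IsRightOption (atom b) H := by
  cases H with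
  | atom c => simp only [Identical] at h
  | comp ι κ L R hι hκ =>
    simp only [Identical] at h
    obtain ⟨⟨h1, h2⟩, h3, h4⟩ := h
    refine ⟨?_, ?_, ?_, ?_⟩
    · rintro _ ⟨i, rfl⟩
      obtain ⟨_, hi⟩ := h1 i
      exact identical_atom hi
    · rintro _ ⟨i, rfl⟩
      obtain ⟨_, hi⟩ := h3 i
      exact identical_atom hi
    · obtain ⟨i, hi⟩ := h2 ()
      exact ⟨i, identical_atom hi⟩
    · obtain ⟨i, hi⟩ := h4 ()
      exact ⟨i, identical_atom hi⟩

theorem simple_le [PartialOrder α] {H K : Game α} {a b a' b' : α}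
    (h : Identical H (comp Unit Unit (fun _ => atom a) (fun _ => atom b) ⟨()⟩ ⟨()⟩))
    (k : Identical K (comp Unit Unit (fun _ => atom a') (fun _ => atom b') ⟨()⟩ ⟨()⟩))
    (ha : a ≤ a') (hb : b ≤ b') : Le H K := by
  obtain ⟨h1, h2, h3, h4⟩ := identical_simple h
  obtain ⟨k1, k2, k3, k4⟩ := identical_simple k
  refine Le.mk ?_ ?_ ?_
  · intro H' hH'
    rw [h1 _ hH']
    exact Tri.inl k3 (atoms_le ha)
  · intro K' hK'
    rw [k2 _ hK']
    exact Tri.inr h4 (atoms_le hb)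
  · rintro g _ rfl
    exact h3.elim

/-- Let `G` be a composite premotive game with parity, none of whose
options are dominated and all of whose reversible options are simple. If `G ≃ [x]`
for some `x`, then `G` is identical to `⟨⟨[⊥]|[x]⟩ | ⟨[x]|[⊤]⟩⟩`. -/
theorem canonical_atomize {α : Type} [PartialOrder α] [OrderBot α] [OrderTop α]
    (G : Game α) (hcomp : IsComposite G) (hprem : Premotive G) (hpar : HasParity G)
    (hnodomL : ∀ H K : Game α, IsLeftOption H G → IsLeftOption K G → K ≠ H → ¬ Le H K)
    (hnodomR : ∀ H K : Game α, IsRightOption H G → IsRightOption K G → K ≠ H → ¬ Le K H)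
    (hsimpleL : ∀ H : Game α, IsLeftOption H G → (∃ K, IsRightOption K H ∧ Le K G) →
      ∃ k : α, Identical H (comp Unit Unit (fun _ => atom ⊥) (fun _ => atom k) ⟨()⟩ ⟨()⟩))
    (hsimpleR : ∀ H : Game α, IsRightOption H G → (∃ K, IsLeftOption K H ∧ Le G K) →
      ∃ k : α, Identical H (comp Unit Unit (fun _ => atom k) (fun _ => atom ⊤) ⟨()⟩ ⟨()⟩))
    (x : α) (hx₁ : Le G (atom x)) (hx₂ : Le (atom x) G) :
    Identical G (comp Unit Unit
      (fun _ => comp Unit Unit (fun _ => atom ⊥) (fun _ => atom x) ⟨()⟩ ⟨()⟩)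
      (fun _ => comp Unit Unit (fun _ => atom x) (fun _ => atom ⊤) ⟨()⟩ ⟨()⟩)
      ⟨()⟩ ⟨()⟩) := by
  have hL : ∀ H, IsLeftOption H G → ∃ k : α, k ≤ x ∧
      Identical H (comp Unit Unit (fun _ => atom ⊥) (fun _ => atom k) ⟨()⟩ ⟨()⟩) := by
    intro H hH
    obtain ⟨K, hK, hle⟩ := tri_atom_right (le_atom_left hx₁ H hH)
    obtain ⟨k, hk⟩ := hsimpleL H hH ⟨K, hK, le_trans_atom x K G hle hx₂⟩
    rw [(identical_simple hk).2.1 K hK] at hle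
    exact ⟨k, le_atoms hle, hk⟩
  have hR : ∀ H, IsRightOption H G → ∃ k : α, x ≤ k ∧
      Identical H (comp Unit Unit (fun _ => atom k) (fun _ => atom ⊤) ⟨()⟩ ⟨()⟩) := by
    intro H hH
    obtain ⟨K, hK, hle⟩ := tri_atom_left (le_atom_right hx₂ H hH)
    obtain ⟨k, hk⟩ := hsimpleR H hH ⟨K, hK, le_trans_atom x G K hx₁ hle⟩
    rw [(identical_simple hk).1 K hK] at hle
    exact ⟨k, le_atoms hle, hk⟩
  -- the key existence statement, from local premotivity
  have key : ∃ HL HR, IsLeftOption HL G ∧ IsRightOption HR G ∧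
      Identical HL (comp Unit Unit (fun _ => atom ⊥) (fun _ => atom x) ⟨()⟩ ⟨()⟩) ∧
      Identical HR (comp Unit Unit (fun _ => atom x) (fun _ => atom ⊤) ⟨()⟩ ⟨()⟩) := by
    have fin : ∀ HL HR k m, IsLeftOption HL G → IsRightOption HR G → k ≤ x → x ≤ m →
        Identical HL (comp Unit Unit (fun _ => atom ⊥) (fun _ => atom k) ⟨()⟩ ⟨()⟩) →
        Identical HR (comp Unit Unit (fun _ => atom m) (fun _ => atom ⊤) ⟨()⟩ ⟨()⟩) →
        LeftWinsFirst (comparison (atom m) (atom k)) →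
        ∃ HL HR, IsLeftOption HL G ∧ IsRightOption HR G ∧
          Identical HL (comp Unit Unit (fun _ => atom ⊥) (fun _ => atom x) ⟨()⟩ ⟨()⟩) ∧
          Identical HR (comp Unit Unit (fun _ => atom x) (fun _ => atom ⊤) ⟨()⟩ ⟨()⟩) := by
      intro HL HR k m h1 h2 hk hm i1 i2 hw
      have hmk : m ≤ k := by
        rcases wins_first hw with ⟨a, b, ha, hb, hab⟩ | ⟨_, h, _⟩ | ⟨_, h, _⟩
        · cases ha
          cases hb
          exact hab
        · exact h.elim
        · exact h.elim
      obtain rfl : k = x := le_antisymm hk (hm.trans hmk)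
      obtain rfl : m = k := le_antisymm hmk hm
      exact ⟨HL, HR, h1, h2, i1, i2⟩
    have hloc : LeftWinsFirst (comparison G G) := hprem G Relation.ReflTransGen.refl
    rcases wins_first hloc with ⟨a, b, rfl, _, _⟩ | ⟨HR, hHR, hw⟩ | ⟨HL, hHL, hw⟩
    · exact hcomp.elim
    · obtain ⟨m, hm, im⟩ := hR HR hHR
      have hw2 := (wins_second hw).1 _ (identical_simple im).2.2.1
      rcases wins_first hw2 with ⟨a, b, _, rfl, _⟩ | ⟨_, h, _⟩ | ⟨HL, hHL, hw3⟩
      · exact hcomp.elim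
      · exact h.elim
      · obtain ⟨k, hk, ik⟩ := hL HL hHL
        exact fin HL HR k m hHL hHR hk hm ik im
          ((wins_second hw3).2 _ (identical_simple ik).2.2.2)
    · obtain ⟨k, hk, ik⟩ := hL HL hHL
      have hw2 := (wins_second hw).2 _ (identical_simple ik).2.2.2
      rcases wins_first hw2 with ⟨a, b, rfl, _, _⟩ | ⟨HR, hHR, hw3⟩ | ⟨_, h, _⟩
      · exact hcomp.elim
      · obtain ⟨m, hm, im⟩ := hR HR hHR
        exact fin HL HR k m hHL hHR hk hm ik im
          ((wins_second hw3).1 _ (identical_simple im).2.2.1)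
      · exact h.elim
  obtain ⟨HL, HR, hHL, hHR, iL, iR⟩ := key
  have uL : ∀ H, IsLeftOption H G →
      Identical H (comp Unit Unit (fun _ => atom ⊥) (fun _ => atom x) ⟨()⟩ ⟨()⟩) := by
    intro H hH
    by_cases he : HL = H
    · exact he ▸ iL
    · obtain ⟨k, hk, ik⟩ := hL H hH
      exact absurd (simple_le ik iL le_rfl hk) (hnodomL H HL hH hHL he)
  have uR : ∀ H, IsRightOption H G →
      Identical H (comp Unit Unit (fun _ => atom x) (fun _ => atom ⊤) ⟨()⟩ ⟨()⟩) := by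
    intro H hH
    by_cases he : HR = H
    · exact he ▸ iR
    · obtain ⟨k, hk, ik⟩ := hR H hH
      exact absurd (simple_le iR ik hk le_rfl) (hnodomR H HR hH hHR he)
  cases G with
  | atom a => exact hcomp.elim
  | comp ι κ L R hι hκ =>
    rw [Identical]
    refine ⟨⟨fun i => ⟨(), uL _ ⟨i, rfl⟩⟩, fun _ => ?_⟩, fun i => ⟨(), uR _ ⟨i, rfl⟩⟩, fun _ => ?_⟩
    · exact hι.elim fun i => ⟨i, uL _ ⟨i, rfl⟩⟩
    · exact hκ.elim fun i => ⟨i, uR _ ⟨i, rfl⟩⟩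

end Game
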